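/- arXiv:2102.05179 — 2 statements merged into one kernel-verified Lean document; each statement's English description precedes it below -/
import Mathlib

section
/- (Corollary 1, H₂ bound) Let M and D be real symmetric positive definite n×n matrices, L̂ a real symmetric positive semidefinite n×n matrix whose kernel is the one-dimensional span of a nonzero vector υ̂ ∈ ℝⁿ, B ∈ ℝ^{n×m}, C ∈ ℝ^{q×n}, and let V be a real n×r matrix with orthonormal columns such that υ̂ lies in the column space of V. Then the function ω ↦ ‖H(iω) − H_r(iω)‖_F² is Lebesgue-integrable over ℝ; i.e. the error system has finite H₂ norm. -/
open Matrix Filter Topology MeasureTheory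

attribute [local instance] Matrix.frobeniusNormedAddCommGroup

section FrobeniusBounds

attribute [local instance] Matrix.frobeniusNormedSpace

variable {n p : Type*} [Fintype n] [Fintype p]

theorem frobenius_norm_sq (X : Matrix n p ℂ) : ‖X‖ ^ 2 = ∑ i, ∑ j, ‖X i j‖ ^ 2 := by
  rw [Matrix.frobenius_norm_def, ← Real.sqrt_eq_rpow, Real.sq_sqrt (by positivity)]
  simp

theorem norm_entry_le_frobenius (X : Matrix n p ℂ) (i : n) (j : p) : ‖X i j‖ ≤ ‖X‖ := by
  refine le_of_sq_le_sq ?_ (norm_nonneg _)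
  rw [frobenius_norm_sq]
  exact (Finset.single_le_sum (f := fun j => ‖X i j‖ ^ 2) (fun _ _ => by positivity)
    (Finset.mem_univ j)).trans
    (Finset.single_le_sum (f := fun i => ∑ j, ‖X i j‖ ^ 2) (fun _ _ => by positivity)
    (Finset.mem_univ i))

theorem norm_trace_le_frobenius (X : Matrix n n ℂ) : ‖X.trace‖ ≤ Fintype.card n * ‖X‖ := by
  refine (norm_sum_le _ _).trans ((Finset.sum_le_card_nsmul _ _ ‖X‖ fun i _ => ?_).trans_eq ?_)
  · exact norm_entry_le_frobenius X i i
  · simp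

theorem re_trace_conjTranspose_mul_self (X : Matrix n p ℂ) : (Xᴴ * X).trace.re = ‖X‖ ^ 2 := by
  rw [frobenius_norm_sq, Finset.sum_comm]
  simp only [trace, diag_apply, mul_apply, conjTranspose_apply, Complex.re_sum]
  refine Finset.sum_congr rfl fun j _ => Finset.sum_congr rfl fun i _ => ?_
  rw [← Complex.normSq_eq_norm_sq, Complex.normSq_apply]
  simp

theorem im_trace_conj_eq_zero {A : Matrix n n ℝ} (hA : A.IsSymm) (X : Matrix n p ℂ) :
    (Xᴴ * A.map Complex.ofRealHom * X).trace.im = 0 := by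
  rw [← Complex.conj_eq_iff_im]
  change star _ = _
  rw [← trace_conjTranspose]
  congr 1
  have : (A.map Complex.ofRealHom)ᴴ = A.map Complex.ofRealHom := by
    ext i j
    simp [hA.apply i j]
  rw [conjTranspose_mul, conjTranspose_mul, this, conjTranspose_conjTranspose, Matrix.mul_assoc]

theorem exists_coercive [DecidableEq n] {D : Matrix n n ℝ} (hD : D.PosDef) :
    ∃ c : ℝ, 0 ≤ c ∧ ∀ X : Matrix n p ℂ,
      ‖X‖ ^ 2 ≤ c * (Xᴴ * D.map Complex.ofRealHom * X).trace.re := by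
  obtain ⟨S, hS, hDS⟩ : ∃ S : Matrix n n ℝ, IsUnit S ∧ D = Sᵀ * S := by
    open scoped MatrixOrder in
    obtain ⟨S, hS, hDS⟩ := CStarAlgebra.isStrictlyPositive_iff_eq_star_mul_self.mp
      hD.isStrictlyPositive
    exact ⟨S, hS, by simpa [star_eq_conjTranspose] using hDS⟩
  refine ⟨‖(S⁻¹).map Complex.ofRealHom‖ ^ 2, by positivity, fun X => ?_⟩
  have hinv : X = (S⁻¹).map Complex.ofRealHom * (S.map Complex.ofRealHom * X) := by
    rw [← Matrix.mul_assoc, ← Matrix.map_mul,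
      Matrix.nonsing_inv_mul _ ((isUnit_iff_isUnit_det _).mp hS)]
    simp
  have hform : Xᴴ * D.map Complex.ofRealHom * X =
      (S.map Complex.ofRealHom * X)ᴴ * (S.map Complex.ofRealHom * X) := by
    have : (S.map Complex.ofRealHom)ᴴ = Sᵀ.map Complex.ofRealHom := by
      ext i j
      simp
    rw [conjTranspose_mul, this, hDS, Matrix.map_mul]
    simp only [Matrix.mul_assoc]
  rw [hform, re_trace_conjTranspose_mul_self, ← mul_pow]
  refine pow_le_pow_left₀ (norm_nonneg _) ?_ 2
  nth_rewrite 1 [hinv]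
  exact Matrix.frobenius_norm_mul _ _

/-- The quadratic pencil `s²M + sD + L`. -/
noncomputable def pencil (M D L : Matrix n n ℝ) (s : ℂ) : Matrix n n ℂ :=
  s ^ 2 • M.map Complex.ofRealHom + s • D.map Complex.ofRealHom + L.map Complex.ofRealHom

theorem pencil_energy_bound [DecidableEq n] {M D L : Matrix n n ℝ} (hM : M.IsSymm) (hD : D.PosDef)
    (hL : L.IsSymm) :
    ∃ c : ℝ, 0 ≤ c ∧ ∀ (ω : ℝ) (X : Matrix n p ℂ),
      |ω| * ‖X‖ ≤ c * ‖pencil M D L (ω * Complex.I) * X‖ := by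
  obtain ⟨c, hc, h⟩ := exists_coercive (p := p) hD
  refine ⟨c * Fintype.card p, by positivity, fun ω X => ?_⟩
  set Y := pencil M D L (ω * Complex.I) * X with hY
  have him : (Xᴴ * Y).trace.im = ω * (Xᴴ * D.map Complex.ofRealHom * X).trace.re := by
    have e : Xᴴ * Y = ((-ω ^ 2 : ℝ) : ℂ) • (Xᴴ * M.map Complex.ofRealHom * X)
        + (ω * Complex.I) • (Xᴴ * D.map Complex.ofRealHom * X)
        + Xᴴ * L.map Complex.ofRealHom * X := by
      have : ((ω : ℂ) * Complex.I) ^ 2 = ((-ω ^ 2 : ℝ) : ℂ) := by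
        rw [mul_pow, Complex.I_sq]
        push_cast
        ring
      rw [hY, pencil, this]
      simp only [Matrix.add_mul, Matrix.mul_add, Matrix.smul_mul, Matrix.mul_smul,
        Matrix.mul_assoc]
    rw [e]
    simp [trace_add, trace_smul, im_trace_conj_eq_zero hM, im_trace_conj_eq_zero hL,
      -Complex.ofReal_neg, -Complex.ofReal_pow]
  have hXY : ‖(Xᴴ * Y).trace‖ ≤ Fintype.card p * (‖X‖ * ‖Y‖) := by
    refine (norm_trace_le_frobenius _).trans ?_
    gcongr
    simpa using Matrix.frobenius_norm_mul Xᴴ Y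
  have hre : 0 ≤ c * (Xᴴ * D.map Complex.ofRealHom * X).trace.re := (sq_nonneg _).trans (h X)
  rcases (norm_nonneg X).eq_or_lt with h0 | h0
  · rw [← h0]
    simp only [mul_zero]
    positivity
  refine le_of_mul_le_mul_right ?_ h0
  calc |ω| * ‖X‖ * ‖X‖ = |ω| * ‖X‖ ^ 2 := by ring
    _ ≤ |ω| * (c * (Xᴴ * D.map Complex.ofRealHom * X).trace.re) := by gcongr; exact h X
    _ = c * |(Xᴴ * Y).trace.im| := by
      rw [him, ← abs_of_nonneg hre, abs_mul, abs_mul, abs_of_nonneg hc]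
      ring
    _ ≤ c * (Fintype.card p * (‖X‖ * ‖Y‖)) := by
      gcongr
      exact (Complex.abs_im_le_norm _).trans hXY
    _ = c * Fintype.card p * ‖Y‖ * ‖X‖ := by ring

theorem isUnit_det_pencil [DecidableEq n] {M D L : Matrix n n ℝ} (hM : M.IsSymm) (hD : D.PosDef)
    (hL : L.IsSymm) {ω : ℝ} (hω : ω ≠ 0) : IsUnit (pencil M D L (ω * Complex.I)).det := by
  rw [isUnit_iff_ne_zero]
  intro hdet
  obtain ⟨x, hx, hKx⟩ := exists_mulVec_eq_zero_iff.mpr hdet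
  obtain ⟨c, -, h⟩ := pencil_energy_bound (p := Unit) hM hD hL
  have h1 := h ω (replicateCol Unit x)
  rw [← replicateCol_mulVec, hKx, replicateCol_zero, norm_zero, mul_zero] at h1
  have h2 : ‖replicateCol Unit x‖ = 0 :=
    le_antisymm (by_contra fun h => (mul_pos (abs_pos.mpr hω) (not_le.mp h)).not_ge h1)
      (norm_nonneg _)
  exact hx (by simpa using h2)

/-- `(vᵀDv)⁻¹ v vᵀ`: the residue at `0` of the inverse pencil when `ker L = span v`. -/
noncomputable def residueMatrix (D : Matrix n n ℝ) (v : n → ℝ) : Matrix n n ℝ :=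
  (v ⬝ᵥ D *ᵥ v)⁻¹ • vecMulVec v v

theorem exists_mul_eq_one_sub_mul_residueMatrix [DecidableEq n] {D L : Matrix n n ℝ}
    (hD : D.PosDef) (hL : L.IsSymm)
    {v : n → ℝ} (hv : v ≠ 0) (hLv : L *ᵥ v = 0) (hker : ∀ x, L *ᵥ x = 0 → ∃ a : ℝ, x = a • v) :
    ∃ Y : Matrix n n ℝ, L * Y = 1 - D * residueMatrix D v := by
  have hvL : v ᵥ* L = 0 := by rw [← mulVec_transpose, hL.eq, hLv]
  have hvv : v ⬝ᵥ v ≠ 0 := by simpa using hv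
  have hvDv : v ⬝ᵥ D *ᵥ v ≠ 0 := by simpa using (hD.dotProduct_mulVec_pos hv).ne'
  have hDs : Dᵀ = D := by simpa using hD.isHermitian.eq
  have hN : v ᵥ* (1 - D * residueMatrix D v) = 0 := by
    rw [vecMul_sub, vecMul_one, residueMatrix, Matrix.mul_smul, vecMul_smul, mul_vecMulVec,
      vecMul_vecMulVec, smul_smul, inv_mul_cancel₀ hvDv, one_smul, sub_self]
  have hleft : v ᵥ* (L + vecMulVec v v) = (v ⬝ᵥ v) • v := by
    rw [vecMul_add, hvL, vecMul_vecMulVec, zero_add]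
  have hunit : IsUnit (L + vecMulVec v v).det := by
    rw [isUnit_iff_ne_zero]
    intro hdet
    obtain ⟨x, hx, hKx⟩ := exists_mulVec_eq_zero_iff.mpr hdet
    have h1 : v ⬝ᵥ x = 0 := by
      have := congrArg (v ⬝ᵥ ·) hKx
      simp only [dotProduct_mulVec, hleft, smul_dotProduct, dotProduct_zero, smul_eq_mul] at this
      exact (mul_eq_zero.mp this).resolve_left hvv
    rw [add_mulVec, vecMulVec_mulVec, h1] at hKx
    obtain ⟨a, rfl⟩ := hker x (by simpa using hKx)
    rw [dotProduct_smul, smul_eq_mul] at h1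
    exact hx (by rw [(mul_eq_zero.mp h1).resolve_right hvv, zero_smul])
  set Y := (L + vecMulVec v v)⁻¹ * (1 - D * residueMatrix D v)
  have hY : (L + vecMulVec v v) * Y = 1 - D * residueMatrix D v :=
    Matrix.mul_nonsing_inv_cancel_left _ _ hunit
  have hvY : v ᵥ* Y = 0 := by
    have := congrArg (v ᵥ* ·) hY
    simp only [← vecMul_vecMul, hleft, hN, smul_vecMul] at this
    exact (smul_eq_zero.mp this).resolve_left hvv
  refine ⟨Y, ?_⟩
  rwa [Matrix.add_mul, vecMulVec_mul, hvY, vecMulVec_zero, add_zero] at hY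

theorem exists_pencil_inv_bound [DecidableEq n] {M D L : Matrix n n ℝ} (hM : M.IsSymm)
    (hD : D.PosDef) (hL : L.IsSymm) {v : n → ℝ} (hv : v ≠ 0) (hLv : L *ᵥ v = 0)
    (hker : ∀ x, L *ᵥ x = 0 → ∃ a : ℝ, x = a • v) :
    ∃ c : ℝ, ∀ ω : ℝ, ω ≠ 0 → |ω| * ‖(pencil M D L (ω * Complex.I))⁻¹‖ ≤ c ∧
      (|ω| ≤ 1 → ‖(pencil M D L (ω * Complex.I))⁻¹ -
        (ω * Complex.I)⁻¹ • (residueMatrix D v).map Complex.ofRealHom‖ ≤ c) := by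
  obtain ⟨c₁, hc₁, h₁⟩ := pencil_energy_bound (p := n) hM hD hL
  obtain ⟨Y, hY⟩ := exists_mul_eq_one_sub_mul_residueMatrix hD hL hv hLv hker
  have hLP : L * residueMatrix D v = 0 := by
    rw [residueMatrix, Matrix.mul_smul, mul_vecMulVec, hLv, zero_vecMulVec, smul_zero]
  set P := residueMatrix D v
  let R : Matrix n n ℝ → Matrix n n ℂ := fun A => A.map Complex.ofRealHom
  have hYc : R L * R Y = 1 - R D * R P := by
    have := congrArg R hY
    simpa only [R, Matrix.map_mul, Matrix.map_sub Complex.ofRealHom (map_sub _),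
      Matrix.map_one Complex.ofRealHom (map_zero _) (map_one _)] using this
  have hLPc : R L * R P = 0 := by
    have := congrArg R hLP
    simpa only [R, Matrix.map_mul, Matrix.map_zero Complex.ofRealHom (map_zero _)] using this
  set a := c₁ * ‖(1 : Matrix n n ℂ)‖ with ha
  set b := ‖R Y‖ + a * (‖R M * R Y‖ + ‖R D * R Y‖ + ‖R M * R P‖) with hb
  have ha0 : 0 ≤ a := by positivity
  have hb0 : 0 ≤ b := by positivity
  refine ⟨a + b, fun ω hω => ?_⟩
  set s : ℂ := ω * Complex.I with hs
  have hs0 : s ≠ 0 := by simp [hs, hω]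
  have hsn : ‖s‖ = |ω| := by simp [hs]
  have hdet := isUnit_det_pencil hM hD hL hω
  set K := pencil M D L s with hK
  have hKinv : |ω| * ‖K⁻¹‖ ≤ a := by
    simpa [K, s, Matrix.mul_nonsing_inv _ hdet, ha] using h₁ ω K⁻¹
  refine ⟨by linarith, fun hω1 => ?_⟩
  have hdecomp : K⁻¹ - s⁻¹ • R P =
      R Y - (s • K⁻¹) * (s • (R M * R Y) + R D * R Y + R M * R P) := by
    have hKd : K = s ^ 2 • R M + s • R D + R L := rfl
    have e : K * (K⁻¹ - s⁻¹ • R P) =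
        K * (R Y - (s • K⁻¹) * (s • (R M * R Y) + R D * R Y + R M * R P)) := by
      rw [Matrix.mul_sub, Matrix.mul_sub, Matrix.smul_mul, Matrix.mul_smul, Matrix.mul_smul,
        Matrix.mul_nonsing_inv_cancel_left _ _ hdet, Matrix.mul_nonsing_inv _ hdet, hKd]
      simp only [Matrix.add_mul, Matrix.smul_mul, hYc, hLPc, smul_add, smul_smul]
      have e1 : s⁻¹ * s ^ 2 = s := by field_simp
      have e2 : s⁻¹ * s = 1 := inv_mul_cancel₀ hs0
      rw [e1, e2, smul_zero, one_smul, sq]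
      abel
    have := congrArg (K⁻¹ * ·) e
    simpa only [Matrix.nonsing_inv_mul_cancel_left _ _ hdet] using this
  change ‖K⁻¹ - s⁻¹ • R P‖ ≤ _
  rw [hdecomp]
  have hsK : ‖s • K⁻¹‖ ≤ a := by rwa [norm_smul, hsn]
  have hsM : ‖s • (R M * R Y)‖ ≤ ‖R M * R Y‖ := by
    rw [norm_smul, hsn]
    exact mul_le_of_le_one_left (norm_nonneg _) hω1
  have hprod : ‖(s • K⁻¹) * (s • (R M * R Y) + R D * R Y + R M * R P)‖ ≤
      a * (‖R M * R Y‖ + ‖R D * R Y‖ + ‖R M * R P‖) := by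
    refine (Matrix.frobenius_norm_mul _ _).trans ?_
    gcongr
    exact norm_add₃_le.trans (by gcongr)
  linarith [norm_sub_le (R Y) ((s • K⁻¹) * (s • (R M * R Y) + R D * R Y + R M * R P))]

theorem measurable_matrix_inv_apply [DecidableEq n] {K : ℝ → Matrix n n ℂ} (hK : Continuous K)
    (i j : n) :
    Measurable fun ω => (K ω)⁻¹ i j := by
  simp only [Matrix.inv_def, Ring.inverse_eq_inv', Matrix.smul_apply, smul_eq_mul]
  exact hK.matrix_det.measurable.inv.mul (hK.matrix_adjugate.matrix_elem i j).measurable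

theorem measurable_pencil_inv_apply [DecidableEq n] (M D L : Matrix n n ℝ) (i j : n) :
    Measurable fun ω : ℝ => (pencil M D L (ω * Complex.I))⁻¹ i j := by
  refine measurable_matrix_inv_apply (continuous_matrix fun i j => ?_) i j
  simp only [pencil, Matrix.add_apply, Matrix.smul_apply, smul_eq_mul]
  fun_prop

theorem frobenius_norm_mul_mul_le {l q : Type*} [Fintype l] [Fintype q] (C : Matrix l n ℂ)
    (G : Matrix n p ℂ) (B : Matrix p q ℂ) : ‖C * G * B‖ ≤ ‖C‖ * ‖G‖ * ‖B‖ :=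
  (Matrix.frobenius_norm_mul _ _).trans
    (mul_le_mul_of_nonneg_right (Matrix.frobenius_norm_mul _ _) (norm_nonneg _))

/-- Cancellation of the pole at `0` in the difference of two inverse pencils. -/
theorem exists_pencil_inv_sub_bound [DecidableEq n] [DecidableEq p]
    {M D L : Matrix n n ℝ} (hM : M.IsSymm) (hD : D.PosDef) (hL : L.PosSemidef)
    {V : Matrix n p ℝ} (hV : Vᵀ * V = 1) {w : p → ℝ} (hw : w ≠ 0) (hLw : L *ᵥ (V *ᵥ w) = 0)
    (hker : ∀ x, L *ᵥ x = 0 → ∃ a : ℝ, x = a • (V *ᵥ w)) :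
    ∃ c : ℝ, ∀ ω : ℝ, ω ≠ 0 →
      (1 + ω ^ 2) * ‖(pencil M D L (ω * Complex.I))⁻¹ - V.map Complex.ofRealHom *
        (pencil (Vᵀ * M * V) (Vᵀ * D * V) (Vᵀ * L * V) (ω * Complex.I))⁻¹ *
          Vᵀ.map Complex.ofRealHom‖ ^ 2 ≤ c := by
  have hVinj : Function.Injective V.mulVec := fun x y hxy => by
    simpa [mulVec_mulVec, hV] using congrArg (Vᵀ *ᵥ ·) hxy
  have hVw : V *ᵥ w ≠ 0 := fun h => hw (hVinj (by simpa using h))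
  have hLs : L.IsSymm := by simpa [Matrix.IsSymm] using hL.isHermitian.eq
  have hsymm : ∀ {A : Matrix n n ℝ}, A.IsSymm → (Vᵀ * A * V).IsSymm := fun {A} hA => by
    rw [Matrix.IsSymm, transpose_mul, transpose_mul, transpose_transpose, hA.eq, Matrix.mul_assoc]
  have hDr : (Vᵀ * D * V).PosDef := by
    simpa using hD.conjTranspose_mul_mul_same hVinj
  obtain ⟨c₁, h₁⟩ := exists_pencil_inv_bound hM hD hLs hVw hLw hker
  obtain ⟨c₂, h₂⟩ := exists_pencil_inv_bound (hsymm hM) hDr (hsymm hLs) hw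
    (by rw [← mulVec_mulVec, ← mulVec_mulVec, hLw, mulVec_zero]) (fun x hx => by
      have hLx : L *ᵥ (V *ᵥ x) = 0 := by
        rw [← hL.dotProduct_mulVec_zero_iff]
        have := congrArg (x ⬝ᵥ ·) hx
        simpa [← mulVec_mulVec, dotProduct_mulVec x Vᵀ, vecMul_transpose] using this
      obtain ⟨a, ha⟩ := hker _ hLx
      exact ⟨a, hVinj (by rw [ha, mulVec_smul])⟩)
  have hP : V.map Complex.ofRealHom *
      (residueMatrix (Vᵀ * D * V) w).map Complex.ofRealHom * Vᵀ.map Complex.ofRealHom =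
      (residueMatrix D (V *ᵥ w)).map Complex.ofRealHom := by
    rw [← Matrix.map_mul, ← Matrix.map_mul, residueMatrix, residueMatrix, Matrix.mul_smul,
      Matrix.smul_mul, mul_vecMulVec, vecMulVec_mul, vecMul_transpose, ← mulVec_mulVec,
      ← mulVec_mulVec, dotProduct_mulVec w Vᵀ, vecMul_transpose]
  set V' := V.map Complex.ofRealHom
  set W' := Vᵀ.map Complex.ofRealHom
  set c := c₁ + ‖V'‖ * c₂ * ‖W'‖ with hc
  refine ⟨2 * c ^ 2, fun ω hω => ?_⟩
  obtain ⟨hK, hK0⟩ := h₁ ω hω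
  obtain ⟨hKr, hKr0⟩ := h₂ ω hω
  set K := pencil M D L (ω * Complex.I)
  set Kr := pencil (Vᵀ * M * V) (Vᵀ * D * V) (Vᵀ * L * V) (ω * Complex.I)
  set G := K⁻¹ - V' * Kr⁻¹ * W' with hG
  have hfar : |ω| * ‖G‖ ≤ c := by
    calc |ω| * ‖G‖ ≤ |ω| * (‖K⁻¹‖ + ‖V'‖ * ‖Kr⁻¹‖ * ‖W'‖) := by
          gcongr
          exact (norm_sub_le _ _).trans (by gcongr; exact frobenius_norm_mul_mul_le _ _ _)
      _ = |ω| * ‖K⁻¹‖ + ‖V'‖ * (|ω| * ‖Kr⁻¹‖) * ‖W'‖ := by ring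
      _ ≤ c := by rw [hc]; gcongr
  have hfar2 : ω ^ 2 * ‖G‖ ^ 2 ≤ c ^ 2 := by
    rw [← sq_abs ω, ← mul_pow]
    exact pow_le_pow_left₀ (by positivity) hfar 2
  rcases le_total |ω| 1 with h | h
  · have hnear : ‖G‖ ≤ c := by
      have e : G = (K⁻¹ - ((ω : ℂ) * Complex.I)⁻¹ •
          (residueMatrix D (V *ᵥ w)).map Complex.ofRealHom) -
          V' * (Kr⁻¹ - ((ω : ℂ) * Complex.I)⁻¹ •
            (residueMatrix (Vᵀ * D * V) w).map Complex.ofRealHom) * W' := by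
        rw [Matrix.mul_sub, Matrix.sub_mul, Matrix.mul_smul, Matrix.smul_mul, hP, hG]
        abel
      rw [e, hc]
      refine (norm_sub_le _ _).trans (add_le_add (hK0 h) ?_)
      refine (frobenius_norm_mul_mul_le _ _ _).trans ?_
      gcongr
      exact hKr0 h
    have := pow_le_pow_left₀ (norm_nonneg _) hnear 2
    linarith
  · have : 1 * ‖G‖ ^ 2 ≤ ω ^ 2 * ‖G‖ ^ 2 := by
      gcongr
      exact (one_le_sq_iff_one_le_abs ω).mpr h
    linarith

theorem measurable_frobenius_norm {F : ℝ → Matrix n p ℂ}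
    (hF : ∀ i j, Measurable fun ω => F ω i j) : Measurable fun ω => ‖F ω‖ := by
  simp only [Matrix.frobenius_norm_def]
  fun_prop

theorem measurable_matrix_mul_apply {l p : Type*} {F : ℝ → Matrix l n ℂ} {G : ℝ → Matrix n p ℂ}
    (hF : ∀ i j, Measurable fun ω => F ω i j) (hG : ∀ i j, Measurable fun ω => G ω i j)
    (i : l) (j : p) : Measurable fun ω => (F ω * G ω) i j := by
  simp only [Matrix.mul_apply]
  fun_prop

end FrobeniusBounds

/-- (Corollary 1, H₂ bound) Under residue matching, the error system has finite H₂ norm: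
`ω ↦ ‖H(iω) − H_r(iω)‖_F²` is Lebesgue-integrable over `ℝ` (Frobenius norm). -/
theorem stmt15 {n m q r : ℕ} (M D Lhat : Matrix (Fin n) (Fin n) ℝ)
    (hM : M.PosDef) (hD : D.PosDef) (hL : Lhat.PosSemidef)
    (vhat : Fin n → ℝ) (hv0 : vhat ≠ 0)
    (hker : LinearMap.ker Lhat.mulVecLin = Submodule.span ℝ {vhat})
    (B : Matrix (Fin n) (Fin m) ℝ) (C : Matrix (Fin q) (Fin n) ℝ)
    (V : Matrix (Fin n) (Fin r) ℝ) (hV : Vᵀ * V = (1 : Matrix (Fin r) (Fin r) ℝ))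
    (hrange : vhat ∈ LinearMap.range V.mulVecLin) :
    letI K : ℂ → Matrix (Fin n) (Fin n) ℂ := fun s =>
      s ^ 2 • M.map (Complex.ofReal ·) + s • D.map (Complex.ofReal ·)
        + Lhat.map (Complex.ofReal ·)
    letI H : ℂ → Matrix (Fin q) (Fin m) ℂ := fun s =>
      C.map (Complex.ofReal ·) * (K s)⁻¹ * B.map (Complex.ofReal ·)
    letI Kr : ℂ → Matrix (Fin r) (Fin r) ℂ := fun s =>
      s ^ 2 • (Vᵀ * M * V).map (Complex.ofReal ·) + s • (Vᵀ * D * V).map (Complex.ofReal ·)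
        + (Vᵀ * Lhat * V).map (Complex.ofReal ·)
    letI Hr : ℂ → Matrix (Fin q) (Fin m) ℂ := fun s =>
      (C * V).map (Complex.ofReal ·) * (Kr s)⁻¹ * (Vᵀ * B).map (Complex.ofReal ·)
    Integrable (fun ω : ℝ =>
      ‖H ((ω : ℂ) * Complex.I) - Hr ((ω : ℂ) * Complex.I)‖ ^ 2) := by
  obtain ⟨w, rfl⟩ := hrange
  rw [mulVecLin_apply] at hv0 hker
  have hmem : ∀ x, Lhat *ᵥ x = 0 ↔ ∃ a : ℝ, a • (V *ᵥ w) = x := fun x => by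
    rw [← Submodule.mem_span_singleton, ← hker, LinearMap.mem_ker, mulVecLin_apply]
  have hM' : M.IsSymm := by simpa [Matrix.IsSymm] using hM.isHermitian.eq
  obtain ⟨c, hc⟩ := exists_pencil_inv_sub_bound hM' hD hL hV
    (fun h => hv0 (by rw [h, mulVec_zero])) ((hmem _).mpr ⟨1, one_smul _ _⟩)
    (fun x hx => ((hmem x).mp hx).imp fun _ => Eq.symm)
  let C' := C.map Complex.ofRealHom
  let B' := B.map Complex.ofRealHom
  let H : ℝ → Matrix (Fin q) (Fin m) ℂ := fun ω =>
    C' * (pencil M D Lhat (ω * Complex.I))⁻¹ * B'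
  let Hr : ℝ → Matrix (Fin q) (Fin m) ℂ := fun ω =>
    (C * V).map Complex.ofRealHom *
      (pencil (Vᵀ * M * V) (Vᵀ * D * V) (Vᵀ * Lhat * V) (ω * Complex.I))⁻¹ *
      (Vᵀ * B).map Complex.ofRealHom
  change Integrable fun ω : ℝ => ‖H ω - Hr ω‖ ^ 2
  have hmeasH : ∀ i j, Measurable fun ω : ℝ => H ω i j :=
    measurable_matrix_mul_apply (measurable_matrix_mul_apply (fun _ _ => measurable_const)
      (measurable_pencil_inv_apply M D Lhat)) fun _ _ => measurable_const
  have hmeasHr : ∀ i j, Measurable fun ω : ℝ => Hr ω i j :=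
    measurable_matrix_mul_apply (measurable_matrix_mul_apply (fun _ _ => measurable_const)
      (measurable_pencil_inv_apply (Vᵀ * M * V) (Vᵀ * D * V) (Vᵀ * Lhat * V)))
      fun _ _ => measurable_const
  have hmeas : Measurable fun ω : ℝ => ‖H ω - Hr ω‖ ^ 2 :=
    (measurable_frobenius_norm fun i j => (hmeasH i j).sub (hmeasHr i j)).pow_const 2
  refine (integrable_inv_one_add_sq.const_mul ((‖C'‖ * ‖B'‖) ^ 2 * c)).mono'
    hmeas.aestronglyMeasurable ?_
  filter_upwards [compl_mem_ae_iff.mpr (measure_singleton (0 : ℝ))] with ω hω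
  have hbound := hc ω hω
  set G := (pencil M D Lhat (ω * Complex.I))⁻¹ - V.map Complex.ofRealHom *
    (pencil (Vᵀ * M * V) (Vᵀ * D * V) (Vᵀ * Lhat * V) (ω * Complex.I))⁻¹ *
      Vᵀ.map Complex.ofRealHom with hG
  have hfactor : H ω - Hr ω = C' * G * B' := by
    simp only [H, Hr]
    rw [hG, Matrix.map_mul, Matrix.map_mul, Matrix.mul_sub, Matrix.sub_mul]
    simp only [C', B', Matrix.mul_assoc]
  have hG2 : ‖G‖ ^ 2 ≤ c * (1 + ω ^ 2)⁻¹ := by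
    rw [← div_eq_mul_inv, le_div_iff₀ (by positivity), mul_comm]
    exact hbound
  rw [hfactor, Real.norm_of_nonneg (by positivity)]
  calc ‖C' * G * B'‖ ^ 2 ≤ (‖C'‖ * ‖G‖ * ‖B'‖) ^ 2 :=
        pow_le_pow_left₀ (norm_nonneg _) (frobenius_norm_mul_mul_le _ _ _) 2
    _ = (‖C'‖ * ‖B'‖) ^ 2 * ‖G‖ ^ 2 := by ring
    _ ≤ (‖C'‖ * ‖B'‖) ^ 2 * (c * (1 + ω ^ 2)⁻¹) := by gcongr
    _ = (‖C'‖ * ‖B'‖) ^ 2 * c * (1 + ω ^ 2)⁻¹ := by ring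
end

section
/- (Proposition 1) Let M and D be real symmetric positive definite n×n matrices, L a real symmetric positive semidefinite n×n matrix whose kernel is the one-dimensional span of the all-ones vector 𝟙, B ∈ ℝ^{n×m}, C ∈ ℝ^{q×n}. Let g : {1,…,n} → {1,…,ν} assign each node to a parameter group and let e_k ∈ ℝⁿ be the indicator vector of g⁻¹(k). Let V be a real n×r matrix with orthonormal columns whose column space contains every e_k, k = 1,…,ν. Then for every p = (p₁,…,p_ν) with all p_k ≠ 0, setting P = diag(p_{g(1)},…,p_{g(n)}), L(p) = PLP, υ_p = P⁻¹𝟙, and H_r(s,p) = CV(s²VᵀMV + sVᵀDV + VᵀL(p)V)⁻¹VᵀB, the reduced transfer function H_r(·,p) has a simple pole at s = 0 with the same residue as the full model: s·H_r(s,p) → (υ_pᵀDυ_p)⁻¹ C υ_p υ_pᵀ B as s → 0 with s ≠ 0, and this limit equals lim_{s→0} s·C(s²M + sD + L(p))⁻¹B. -/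
open Matrix Filter Topology

/-- If `A * Q = 0` and `A + D * Q` is invertible, then the quadratic matrix pencil
`s²M + sD + A` is invertible near `s = 0`, and its inverse has at most a simple pole there,
with residue `Q * (A + D * Q)⁻¹`. -/
theorem quadraticPencil_residue {ι : Type*} [Fintype ι] [DecidableEq ι]
    (M D A Q : Matrix ι ι ℂ) (hQ : A * Q = 0) (hU : IsUnit (A + D * Q)) :
    (∀ᶠ s : ℂ in 𝓝[≠] 0, IsUnit (s ^ 2 • M + s • D + A)) ∧
    Tendsto (fun s : ℂ => s • (s ^ 2 • M + s • D + A)⁻¹) (𝓝[≠] 0)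
      (𝓝 (Q * (A + D * Q)⁻¹)) := by
  set F : ℂ → Matrix ι ι ℂ := fun s =>
    (s ^ 2 • M + s • D + A) * (1 - Q) + (s • M + D) * Q with hF
  have hF0 : F 0 = A + D * Q := by simp [hF, mul_sub, hQ]
  have hFc : Continuous F := by fun_prop
  have hdet : ∀ᶠ s in 𝓝[≠] (0 : ℂ), (F s).det ≠ 0 := by
    refine nhdsWithin_le_nhds (hFc.matrix_det.continuousAt.eventually_ne ?_)
    rw [hF0]
    exact ((Matrix.isUnit_iff_isUnit_det _).1 hU).ne_zero
  have hinv : ∀ s : ℂ, s ≠ 0 → (F s).det ≠ 0 →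
      (s ^ 2 • M + s • D + A) * (s⁻¹ • ((s • (1 - Q) + Q) * (F s)⁻¹)) = 1 := by
    intro s hs hd
    have h : (s ^ 2 • M + s • D + A) * (s • (1 - Q) + Q) = s • F s := by
      simp only [hF, mul_add, add_mul, smul_add, Matrix.smul_mul, Matrix.mul_smul, hQ, smul_smul,
        pow_two]
      abel
    rw [Matrix.mul_smul, ← Matrix.mul_assoc, h, Matrix.smul_mul,
      Matrix.mul_nonsing_inv _ (isUnit_iff_ne_zero.2 hd), smul_smul, inv_mul_cancel₀ hs, one_smul]
  have hne : ∀ᶠ s in 𝓝[≠] (0 : ℂ), s ≠ 0 := eventually_mem_nhdsWithin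
  constructor
  · filter_upwards [hdet, hne] with s hd hs
    exact (Matrix.isUnit_iff_isUnit_det _).2 (Matrix.isUnit_det_of_right_inverse (hinv s hs hd))
  · have hlim : Tendsto (fun s : ℂ => (s • (1 - Q) + Q) * (F s)⁻¹) (𝓝[≠] 0)
        (𝓝 (Q * (A + D * Q)⁻¹)) := by
      have hFinv : ContinuousAt (fun s => (F s)⁻¹) 0 := by
        refine ContinuousAt.comp (g := Inv.inv) (continuousAt_matrix_inv _ ?_)
          hFc.continuousAt
        rw [hF0]
        simpa only [Ring.inverse_eq_inv'] using
          continuousAt_inv₀ ((Matrix.isUnit_iff_isUnit_det _).1 hU).ne_zero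
      have hG : ContinuousAt (fun s : ℂ => s • (1 - Q) + Q) 0 := by fun_prop
      have h := hG.tendsto.mul hFinv.tendsto
      rw [hF0, zero_smul, zero_add] at h
      exact h.mono_left nhdsWithin_le_nhds
    refine hlim.congr' ?_
    filter_upwards [hdet, hne] with s hd hs
    rw [Matrix.inv_eq_right_inv (hinv s hs hd), smul_smul, mul_inv_cancel₀ hs, one_smul]

/-- If `D` is positive definite and `A` is symmetric with kernel spanned by `u`, then
`(s²M + sD + A)⁻¹` has at most a simple pole at `s = 0`, with residue `(uᵀDu)⁻¹ u uᵀ`. -/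
theorem secondOrder_residue {ι : Type*} [Fintype ι] [DecidableEq ι]
    (M D A : Matrix ι ι ℝ) (hD : D.PosDef) (hA : Aᵀ = A) (u : ι → ℝ) (hu : A *ᵥ u = 0)
    (hker : ∀ x, A *ᵥ x = 0 → ∃ c : ℝ, x = c • u) :
    (∀ᶠ s : ℂ in 𝓝[≠] 0, IsUnit (s ^ 2 • M.map (Complex.ofReal ·)
      + s • D.map (Complex.ofReal ·) + A.map (Complex.ofReal ·))) ∧
    Tendsto (fun s : ℂ => s • (s ^ 2 • M.map (Complex.ofReal ·)
      + s • D.map (Complex.ofReal ·) + A.map (Complex.ofReal ·))⁻¹) (𝓝[≠] 0)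
      (𝓝 (((u ⬝ᵥ D *ᵥ u)⁻¹ • Matrix.vecMulVec u u).map (Complex.ofReal ·))) := by
  set d := u ⬝ᵥ D *ᵥ u with hd
  set Q : Matrix ι ι ℝ := d⁻¹ • Matrix.vecMulVec u (u ᵥ* D) with hQ
  have hd0 : u ≠ 0 → d ≠ 0 := fun h => by
    simpa using (hD.dotProduct_mulVec_pos h).ne'
  have hu' : u ᵥ* A = 0 := by rw [← hA, Matrix.vecMul_transpose, hu]
  have hAQ : A * Q = 0 := by
    rw [hQ, Matrix.mul_smul, Matrix.mul_vecMulVec, hu]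
    simp
  have hvec : u ᵥ* (A + D * Q) = u ᵥ* D := by
    rcases eq_or_ne u 0 with rfl | h
    · simp
    · rw [Matrix.vecMul_add, hu', zero_add, hQ, ← Matrix.vecMul_vecMul, Matrix.vecMul_smul,
        Matrix.vecMul_vecMulVec, ← Matrix.dotProduct_mulVec, ← hd, smul_smul,
        inv_mul_cancel₀ (hd0 h), one_smul]
  have hF : IsUnit (A + D * Q) := by
    rw [← Matrix.mulVec_injective_iff_isUnit]
    refine (injective_iff_map_eq_zero (A + D * Q).mulVecLin).2 fun x hx => ?_
    rw [Matrix.mulVecLin_apply] at hx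
    have hux : (u ᵥ* D) ⬝ᵥ x = 0 := by
      rw [← hvec, ← Matrix.dotProduct_mulVec, hx, dotProduct_zero]
    have hAx : A *ᵥ x = 0 := by
      rw [Matrix.add_mulVec, ← Matrix.mulVec_mulVec, hQ, Matrix.smul_mulVec,
        Matrix.vecMulVec_mulVec, hux] at hx
      simpa using hx
    obtain ⟨c, rfl⟩ := hker x hAx
    rcases eq_or_ne u 0 with h | h
    · rw [h, smul_zero]
    · rw [← Matrix.dotProduct_mulVec, Matrix.mulVec_smul, dotProduct_smul, ← hd, smul_eq_mul,
        mul_eq_zero] at hux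
      rw [hux.resolve_right (hd0 h), zero_smul]
  have hres : d⁻¹ • Matrix.vecMulVec u u * (A + D * Q) = Q := by
    rw [Matrix.smul_mul, Matrix.vecMulVec_mul, hvec]
  let f := (Complex.ofRealHom).mapMatrix (m := ι)
  have hFc : IsUnit (f A + f D * f Q) := by
    rw [← map_mul, ← map_add]
    exact hF.map f
  have key := quadraticPencil_residue (f M) (f D) (f A) (f Q)
    (by rw [← map_mul, hAQ, map_zero]) hFc
  have hlim : f Q * (f A + f D * f Q)⁻¹ = f (d⁻¹ • Matrix.vecMulVec u u) := by
    have h : f Q = f (d⁻¹ • Matrix.vecMulVec u u) * (f A + f D * f Q) := by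
      rw [← map_mul f D Q, ← map_add, ← map_mul, hres]
    nth_rewrite 1 [h]
    exact Matrix.mul_nonsing_inv_cancel_right _ _ ((Matrix.isUnit_iff_isUnit_det _).1 hFc)
  rw [hlim] at key
  exact key

/-- Galerkin projection onto the range of an injective `V` containing the kernel vector `V *ᵥ y`
of `A` yields a transfer function with at most a simple pole at `s = 0`, with the residue of the
unprojected one. -/
theorem galerkin_residue {ι κ α β : Type*} [Fintype ι] [Fintype κ] [DecidableEq κ]
    (M D A : Matrix ι ι ℝ) (hD : D.PosDef) (hA : A.PosSemidef)
    (B : Matrix ι β ℝ) (C : Matrix α ι ℝ)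
    (V : Matrix ι κ ℝ) (hV : Function.Injective V.mulVec) (y : κ → ℝ) (hy : A *ᵥ (V *ᵥ y) = 0)
    (hker : ∀ x, A *ᵥ x = 0 → ∃ c : ℝ, x = c • (V *ᵥ y)) :
    (∀ᶠ s : ℂ in 𝓝[≠] 0, IsUnit (s ^ 2 • (Vᵀ * M * V).map (Complex.ofReal ·)
      + s • (Vᵀ * D * V).map (Complex.ofReal ·) + (Vᵀ * A * V).map (Complex.ofReal ·))) ∧
    Tendsto (fun s : ℂ => s • ((C * V).map (Complex.ofReal ·) *
      (s ^ 2 • (Vᵀ * M * V).map (Complex.ofReal ·)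
      + s • (Vᵀ * D * V).map (Complex.ofReal ·) + (Vᵀ * A * V).map (Complex.ofReal ·))⁻¹ *
      (Vᵀ * B).map (Complex.ofReal ·))) (𝓝[≠] 0)
      (𝓝 ((((V *ᵥ y) ⬝ᵥ D *ᵥ (V *ᵥ y))⁻¹ •
        (C * Matrix.vecMulVec (V *ᵥ y) (V *ᵥ y) * B)).map (Complex.ofReal ·))) := by
  have hDr : (Vᵀ * D * V).PosDef := by
    simpa using hD.conjTranspose_mul_mul_same hV
  have hAr : (Vᵀ * A * V)ᵀ = Vᵀ * A * V := by
    have h : Aᵀ = A := by simpa using hA.isHermitian.eq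
    simp [Matrix.transpose_mul, h, Matrix.mul_assoc]
  have hyr : (Vᵀ * A * V) *ᵥ y = 0 := by
    rw [← Matrix.mulVec_mulVec, ← Matrix.mulVec_mulVec, hy, Matrix.mulVec_zero]
  have hkr : ∀ x, (Vᵀ * A * V) *ᵥ x = 0 → ∃ c : ℝ, x = c • y := by
    intro x hx
    have h0 : (V *ᵥ x) ⬝ᵥ A *ᵥ (V *ᵥ x) = 0 := by
      have h := congrArg (x ⬝ᵥ ·) hx
      rwa [← Matrix.mulVec_mulVec, ← Matrix.mulVec_mulVec, Matrix.dotProduct_mulVec,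
        Matrix.vecMul_transpose, dotProduct_zero] at h
    obtain ⟨c, hc⟩ := hker _ ((hA.dotProduct_mulVec_zero_iff (V *ᵥ x)).1 (by simpa using h0))
    exact ⟨c, hV (by rw [hc, Matrix.mulVec_smul])⟩
  obtain ⟨hunit, hlim⟩ := secondOrder_residue (Vᵀ * M * V) _ _ hDr hAr y hyr hkr
  refine ⟨hunit, ?_⟩
  have hmul : Continuous fun X : Matrix κ κ ℂ =>
      (C * V).map (Complex.ofReal ·) * X * (Vᵀ * B).map (Complex.ofReal ·) := by fun_prop
  have h := (hmul.tendsto _).comp hlim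
  have hd : y ⬝ᵥ (Vᵀ * D * V) *ᵥ y = (V *ᵥ y) ⬝ᵥ D *ᵥ (V *ᵥ y) := by
    rw [← Matrix.mulVec_mulVec, ← Matrix.mulVec_mulVec, Matrix.dotProduct_mulVec,
      Matrix.vecMul_transpose]
  have hφ : (C * V) * ((y ⬝ᵥ (Vᵀ * D * V) *ᵥ y)⁻¹ • Matrix.vecMulVec y y) * (Vᵀ * B) =
      ((V *ᵥ y) ⬝ᵥ D *ᵥ (V *ᵥ y))⁻¹ • (C * Matrix.vecMulVec (V *ᵥ y) (V *ᵥ y) * B) := by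
    rw [hd, ← Matrix.mul_vecMulVec, ← Matrix.vecMul_transpose V y, ← Matrix.vecMulVec_mul]
    simp only [Matrix.mul_smul, Matrix.smul_mul, Matrix.mul_assoc]
  rw [← hφ]
  have hmap : ((C * V) * ((y ⬝ᵥ (Vᵀ * D * V) *ᵥ y)⁻¹ • Matrix.vecMulVec y y) *
      (Vᵀ * B)).map (Complex.ofReal ·) = (C * V).map (Complex.ofReal ·) *
      ((y ⬝ᵥ (Vᵀ * D * V) *ᵥ y)⁻¹ • Matrix.vecMulVec y y).map (Complex.ofReal ·) *
      (Vᵀ * B).map (Complex.ofReal ·) := by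
    exact (Matrix.map_mul (f := Complex.ofRealHom)).trans
      (congrArg (· * _) (Matrix.map_mul (f := Complex.ofRealHom)))
  rw [hmap]
  refine h.congr fun s => ?_
  simp only [Function.comp_apply, Matrix.mul_smul, Matrix.smul_mul]

/-- (Proposition 1) If the orthonormal basis `V` contains every group indicator vector
`eₖ` in its column space, then for every parameter vector `p` with nonzero entries the
reduced transfer function `H_r(·,p)` retains the simple pole at `s = 0` of the full
parametric model `H(·,p)` and its parameter-dependent residue
`(υ_pᵀDυ_p)⁻¹ C υ_p υ_pᵀ B`, where `υ_p = P⁻¹𝟙`. -/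
theorem stmt17 {n m q ν r : ℕ} (M D L : Matrix (Fin n) (Fin n) ℝ)
    (hM : M.PosDef) (hD : D.PosDef) (hL : L.PosSemidef)
    (hker : LinearMap.ker L.mulVecLin = Submodule.span ℝ {(fun _ => 1 : Fin n → ℝ)})
    (B : Matrix (Fin n) (Fin m) ℝ) (C : Matrix (Fin q) (Fin n) ℝ)
    (g : Fin n → Fin ν)
    (V : Matrix (Fin n) (Fin r) ℝ) (hV : Vᵀ * V = (1 : Matrix (Fin r) (Fin r) ℝ))
    (he : ∀ k : Fin ν,
      (fun i => if g i = k then (1 : ℝ) else 0) ∈ LinearMap.range V.mulVecLin)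
    (p : Fin ν → ℝ) (hp : ∀ k, p k ≠ 0) :
    letI P : Matrix (Fin n) (Fin n) ℝ := Matrix.diagonal (fun i => p (g i))
    letI Lp : Matrix (Fin n) (Fin n) ℝ := P * L * P
    letI υ : Fin n → ℝ := fun i => (p (g i))⁻¹
    letI K : ℂ → Matrix (Fin n) (Fin n) ℂ := fun s =>
      s ^ 2 • M.map (Complex.ofReal ·) + s • D.map (Complex.ofReal ·)
        + Lp.map (Complex.ofReal ·)
    letI H : ℂ → Matrix (Fin q) (Fin m) ℂ := fun s =>
      C.map (Complex.ofReal ·) * (K s)⁻¹ * B.map (Complex.ofReal ·)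
    letI Kr : ℂ → Matrix (Fin r) (Fin r) ℂ := fun s =>
      s ^ 2 • (Vᵀ * M * V).map (Complex.ofReal ·) + s • (Vᵀ * D * V).map (Complex.ofReal ·)
        + (Vᵀ * Lp * V).map (Complex.ofReal ·)
    letI Hr : ℂ → Matrix (Fin q) (Fin m) ℂ := fun s =>
      (C * V).map (Complex.ofReal ·) * (Kr s)⁻¹ * (Vᵀ * B).map (Complex.ofReal ·)
    letI φ : Matrix (Fin q) (Fin m) ℂ :=
      ((υ ⬝ᵥ D.mulVec υ)⁻¹ • (C * Matrix.vecMulVec υ υ * B)).map (Complex.ofReal ·)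
    (∃ ε > (0 : ℝ), ∀ s : ℂ, s ≠ 0 → ‖s‖ < ε → IsUnit (Kr s)) ∧
    Tendsto (fun s : ℂ => s • Hr s) (𝓝[≠] 0) (𝓝 φ) ∧
    Tendsto (fun s : ℂ => s • H s) (𝓝[≠] 0) (𝓝 φ) := by
  set P : Matrix (Fin n) (Fin n) ℝ := Matrix.diagonal (fun i => p (g i))
  set Lp : Matrix (Fin n) (Fin n) ℝ := P * L * P
  set υ : Fin n → ℝ := fun i => (p (g i))⁻¹
  have hPυ : P *ᵥ υ = fun _ => 1 := by
    ext i
    simp [P, υ, Matrix.mulVec_diagonal, hp]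
  have hL1 : L *ᵥ (fun _ => 1) = 0 := by
    have h : (fun _ => 1 : Fin n → ℝ) ∈ LinearMap.ker L.mulVecLin := by
      rw [hker]
      exact Submodule.mem_span_singleton_self _
    simpa using h
  have hLp : Lp.PosSemidef := by
    simpa [P, Lp] using hL.conjTranspose_mul_mul_same P
  have hLpυ : Lp *ᵥ υ = 0 := by
    simp only [Lp]
    rw [← Matrix.mulVec_mulVec, ← Matrix.mulVec_mulVec, hPυ, hL1, Matrix.mulVec_zero]
  have hPapply : ∀ x : Fin n → ℝ, ∀ i, (P *ᵥ x) i = p (g i) * x i := fun x i => by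
    simp [P, Matrix.mulVec_diagonal]
  have hkerLp : ∀ x, Lp *ᵥ x = 0 → ∃ c : ℝ, x = c • υ := by
    intro x hx
    have hLPx : P *ᵥ x ∈ LinearMap.ker L.mulVecLin := by
      simp only [Lp] at hx
      rw [← Matrix.mulVec_mulVec, ← Matrix.mulVec_mulVec] at hx
      rw [LinearMap.mem_ker, Matrix.mulVecLin_apply]
      ext i
      have h := congrFun hx i
      rw [hPapply] at h
      exact (mul_eq_zero.1 h).resolve_left (hp _)
    rw [hker, Submodule.mem_span_singleton] at hLPx
    obtain ⟨c, hc⟩ := hLPx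
    refine ⟨c, ?_⟩
    ext i
    have h := congrFun hc i
    rw [hPapply] at h
    simp only [Pi.smul_apply, smul_eq_mul, mul_one] at h
    simp only [Pi.smul_apply, smul_eq_mul, υ, h]
    field_simp [hp (g i)]
  have hυV : υ ∈ LinearMap.range V.mulVecLin := by
    have h : υ = ∑ k, (p k)⁻¹ • (fun i => if g i = k then (1 : ℝ) else 0) := by
      ext i
      simp [υ, Finset.sum_apply]
    rw [h]
    exact Submodule.sum_mem _ fun k _ => Submodule.smul_mem _ _ (he k)
  obtain ⟨y, hy⟩ := hυV
  rw [Matrix.mulVecLin_apply] at hy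
  have hVinj : Function.Injective V.mulVec := fun a b h => by
    simpa [Matrix.mulVec_mulVec, hV] using congrArg (Vᵀ *ᵥ ·) h
  obtain ⟨hunit, hlim⟩ := galerkin_residue M D Lp hD hLp B C V hVinj y
    (by rw [hy, hLpυ]) (by rw [hy]; exact hkerLp)
  have hfull := (galerkin_residue M D Lp hD hLp B C 1
    (fun a b h => by simpa using h) υ (by simpa using hLpυ) (by simpa using hkerLp)).2
  refine ⟨?_, ?_, ?_⟩
  · rw [eventually_nhdsWithin_iff, Metric.eventually_nhds_iff] at hunit
    obtain ⟨ε, hε, h⟩ := hunit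
    exact ⟨ε, hε, fun s hs hsε => h (by simpa using hsε) hs⟩
  · rw [hy] at hlim
    exact hlim
  · simp only [Matrix.transpose_one, Matrix.one_mul, Matrix.mul_one, Matrix.one_mulVec] at hfull
    exact hfull
end
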